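/- Let p ≥ 2, let a, b, c : ℤ → ℝ be p-periodic sequences with c_i − b_i = k for a fixed constant k ∈ ℝ and all i. Let J be the bounded linear operator on ℓ²(ℤ) defined by (Ju)_n = c_{n−1}u_{n−1} + a_n u_n + b_n u_{n+1}. If for some ε > 0 the ε-pseudospectrum Λ_ε(J) is path-connected, then ω_a ≤ 2(ε + |k|)(p − 1). -/

import Mathlib

/-- The `ε`-pseudospectrum of an element `a` of a complex normed algebra:
the set of `z ∈ ℂ` such that `z - a` is not invertible or `‖(z - a)⁻¹‖ ≥ ε⁻¹`. -/
noncomputable def pseudospectrum {A : Type*} [NormedRing A] [NormedAlgebra ℂ A]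
    (ε : ℝ) (a : A) : Set ℂ :=
  {z : ℂ | z ∈ spectrum ℂ a ∨ ε⁻¹ ≤ ‖Ring.inverse (algebraMap ℂ A z - a)‖}

/-- The oscillation `ω_v = max { |v i - v j| : 0 ≤ i, j ≤ p-1 }` of a `p`-periodic
real sequence `v`. -/
noncomputable def osc (p : ℕ) (v : ℤ → ℝ) : ℝ :=
  ⨆ i : Fin p, ⨆ j : Fin p, |v ((i : ℕ) : ℤ) - v ((j : ℕ) : ℤ)|

section

open scoped InnerProductSpace Pointwise

section GappedPerturbation

variable {H : Type*} [NormedAddCommGroup H] [InnerProductSpace ℂ H]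

/-- If two subspaces of complementary dimension make a symmetric operator negative and positive
definite with constant `δ`, then the operator is bounded below by `δ`. -/
lemma LinearMap.IsSymmetric.norm_le_of_definite_of_finrank_add
    {E X Y : Type*} [NormedAddCommGroup E] [InnerProductSpace ℂ E] [FiniteDimensional ℂ E]
    [AddCommGroup X] [Module ℂ X] [FiniteDimensional ℂ X]
    [AddCommGroup Y] [Module ℂ Y] [FiniteDimensional ℂ Y]
    {T : E →ₗ[ℂ] E} (hT : T.IsSymmetric) {f : X →ₗ[ℂ] E} {g : Y →ₗ[ℂ] E}
    (hf : Function.Injective f) (hg : Function.Injective g)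
    (hdim : Module.finrank ℂ X + Module.finrank ℂ Y = Module.finrank ℂ E)
    {δ : ℝ} (hδ : 0 < δ)
    (hneg : ∀ x, (⟪T (f x), f x⟫_ℂ).re ≤ -δ * ‖f x‖ ^ 2)
    (hpos : ∀ y, δ * ‖g y‖ ^ 2 ≤ (⟪T (g y), g y⟫_ℂ).re) (u : E) :
    δ * ‖u‖ ≤ ‖T u‖ := by
  have hinj : Function.Injective (f.coprod g) := by
    rw [injective_iff_map_eq_zero]
    rintro ⟨x, y⟩ hxy
    rw [LinearMap.coprod_apply] at hxy
    have h : f x = -g y := eq_neg_of_add_eq_zero_left hxy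
    have h1 := hneg x
    have h2 := hpos y
    rw [h] at h1
    simp only [map_neg, inner_neg_neg, norm_neg] at h1
    have h3 : ‖g y‖ ^ 2 ≤ 0 := by nlinarith [sq_nonneg ‖g y‖]
    have h4 : g y = 0 := by
      have := pow_eq_zero_iff (two_ne_zero) |>.1 (le_antisymm h3 (sq_nonneg _))
      exact norm_eq_zero.1 this
    have h5 : f x = 0 := by rw [h, h4, neg_zero]
    rw [(map_eq_zero_iff f hf).1 h5, (map_eq_zero_iff g hg).1 h4]
    rfl
  have hsurj : Function.Surjective (f.coprod g) := by
    refine (LinearMap.injective_iff_surjective_of_finrank_eq_finrank ?_).1 hinj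
    rw [Module.finrank_prod, hdim]
  obtain ⟨⟨x, y⟩, rfl⟩ := hsurj u
  rw [LinearMap.coprod_apply]
  set v := f x
  set w := g y
  have hcross : (⟪T w, v⟫_ℂ).re = (⟪T v, w⟫_ℂ).re := by
    rw [hT w v, ← inner_conj_symm, Complex.conj_re]
  have hexp : (⟪T (v + w), w - v⟫_ℂ).re = (⟪T w, w⟫_ℂ).re - (⟪T v, v⟫_ℂ).re := by
    simp only [map_add, inner_add_left, inner_sub_right, Complex.add_re, Complex.sub_re]
    linarith
  have hcs : (⟪T (v + w), w - v⟫_ℂ).re ≤ ‖T (v + w)‖ * ‖w - v‖ :=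
    (Complex.re_le_norm _).trans (norm_inner_le_norm _ _)
  have hpar := parallelogram_law_with_norm ℂ w v
  have hv := hneg x
  have hw := hpos y
  have hadd : ‖w + v‖ = ‖v + w‖ := by rw [add_comm]
  rw [hadd] at hpar
  have hmain : δ * ‖v + w‖ * ‖w - v‖ ≤ ‖T (v + w)‖ * ‖w - v‖ := by
    nlinarith [sq_nonneg (‖v + w‖ - ‖w - v‖)]
  rcases (norm_nonneg (w - v)).eq_or_lt with h0 | h0
  · have h1 : ‖v‖ ^ 2 + ‖w‖ ^ 2 ≤ 0 := by
      rw [← h0, mul_zero] at hcs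
      nlinarith
    have h2 : ‖v + w‖ = 0 := by
      rw [← h0] at hpar
      nlinarith [norm_nonneg (v + w)]
    rw [h2, mul_zero]
    positivity
  · exact le_of_mul_le_mul_right hmain h0

variable {A K : H →L[ℂ] H} {δ κ : ℝ}

lemma norm_le_norm_sub_imaginary (hA : A.IsSymmetric) (y : ℝ) (x : H) :
    ‖A x‖ ≤ ‖A x - ((y : ℂ) * Complex.I) • x‖ := by
  have him : (⟪A x, ((y : ℂ) * Complex.I) • x⟫_ℂ).re = 0 := by
    have hre : (⟪A x, x⟫_ℂ).im = 0 := by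
      rw [← Complex.conj_eq_iff_im, inner_conj_symm]
      exact (hA x x).symm
    rw [inner_smul_right]
    simp [hre]
  have := @norm_sub_sq ℂ H _ _ _ (A x) (((y : ℂ) * Complex.I) • x)
  simp only [RCLike.re_to_complex, him, mul_zero, sub_zero] at this
  exact le_of_sq_le_sq (by nlinarith [sq_nonneg ‖((y : ℂ) * Complex.I) • x‖]) (norm_nonneg _)

lemma norm_le_perturbed (hA : A.IsSymmetric) (hAδ : ∀ x, δ * ‖x‖ ≤ ‖A x‖)
    (hK : ∀ x, ‖K x‖ ≤ κ * ‖x‖) (y : ℝ) (x : H) :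
    (δ - κ) * ‖x‖ ≤ ‖(A + K - algebraMap ℂ _ ((y : ℂ) * Complex.I)) x‖ := by
  have h1 := norm_le_norm_sub_imaginary hA y x
  have h2 : (A + K - algebraMap ℂ _ ((y : ℂ) * Complex.I)) x
      = (A x - ((y : ℂ) * Complex.I) • x) + K x := by
    simp [Algebra.algebraMap_eq_smul_one]
    abel
  have h3 := norm_sub_le_norm_add (A x - ((y : ℂ) * Complex.I) • x) (K x)
  rw [h2]
  linarith [hAδ x, hK x]

lemma re_inner_perturbed_ge (hκ : κ < δ) (hAδ : ∀ x, δ * ‖x‖ ≤ ‖A x‖)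
    (hK : ∀ x, ‖K x‖ ≤ κ * ‖x‖) (x : H) :
    δ * (δ - κ) * ‖x‖ ^ 2 ≤ (⟪A x, (A + K) x⟫_ℂ).re := by
  have h1 : (⟪A x, (A + K) x⟫_ℂ).re = ‖A x‖ ^ 2 + (⟪A x, K x⟫_ℂ).re := by
    rw [add_apply, inner_add_right, Complex.add_re,
      ← @inner_self_eq_norm_sq ℂ]
    rfl
  have h2 : -(‖A x‖ * ‖K x‖) ≤ (⟪A x, K x⟫_ℂ).re :=
    (neg_le_neg (norm_inner_le_norm (𝕜 := ℂ) (A x) (K x))).trans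
      (neg_le_of_abs_le (Complex.abs_re_le_norm _))
  have h3 : ‖A x‖ * ‖K x‖ ≤ ‖A x‖ * (κ * ‖x‖) :=
    mul_le_mul_of_nonneg_left (hK x) (norm_nonneg _)
  have h5 : δ * ‖x‖ * ((δ - κ) * ‖x‖) ≤ ‖A x‖ * (‖A x‖ - κ * ‖x‖) := by
    apply mul_le_mul (hAδ x) (by linarith [hAδ x]) _ (norm_nonneg _)
    exact mul_nonneg (by linarith) (norm_nonneg _)
  nlinarith

variable [CompleteSpace H]

lemma isUnit_perturbed (hA : A.IsSymmetric) (hκ : κ < δ) (hκ0 : 0 ≤ κ)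
    (hAδ : ∀ x, δ * ‖x‖ ≤ ‖A x‖) (hK : ∀ x, ‖K x‖ ≤ κ * ‖x‖) (y : ℝ) :
    IsUnit (A + K - algebraMap ℂ (H →L[ℂ] H) ((y : ℂ) * Complex.I)) := by
  have key : ∀ (K : H →L[ℂ] H), (∀ x, ‖K x‖ ≤ κ * ‖x‖) → ∀ y : ℝ,
      IsUnit (A * (A + K - algebraMap ℂ (H →L[ℂ] H) ((y : ℂ) * Complex.I))) := by
    intro K hK y
    have hc : 0 < δ * (δ - κ) := mul_pos (by linarith) (by linarith)
    refine ContinuousLinearMap.isUnit_of_forall_le_norm_inner_map _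
      (c := ⟨δ * (δ - κ), hc.le⟩) hc fun x ↦ ?_
    have h1 := re_inner_perturbed_ge hκ hAδ hK x
    have him : (⟪((y : ℂ) * Complex.I) • x, A x⟫_ℂ).re = 0 := by
      have hre : (⟪x, A x⟫_ℂ).im = 0 := by
        rw [← Complex.conj_eq_iff_im, inner_conj_symm]
        exact hA x x
      rw [inner_smul_left]
      simp [hre]
    have h2 : (⟪(A * (A + K - algebraMap ℂ (H →L[ℂ] H) ((y : ℂ) * Complex.I))) x, x⟫_ℂ).re
        = (⟪A x, (A + K) x⟫_ℂ).re := by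
      have : ⟪(A * (A + K - algebraMap ℂ (H →L[ℂ] H) ((y : ℂ) * Complex.I))) x, x⟫_ℂ
          = ⟪(A + K) x, A x⟫_ℂ - ⟪((y : ℂ) * Complex.I) • x, A x⟫_ℂ := by
        rw [← inner_sub_left]
        refine (hA _ x).trans ?_
        simp [Algebra.algebraMap_eq_smul_one]
      rw [this, Complex.sub_re, him, sub_zero, ← inner_conj_symm, Complex.conj_re]
    calc ‖x‖ ^ 2 * (δ * (δ - κ)) ≤ (⟪A x, (A + K) x⟫_ℂ).re := by linarith
      _ ≤ _ := by rw [← h2]; exact Complex.re_le_norm _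
  have hAu : IsUnit A := by
    have h := key 0 (fun x ↦ by simpa using mul_nonneg hκ0 (norm_nonneg x)) 0
    simp only [add_zero, Complex.ofReal_zero, zero_mul, map_zero, sub_zero] at h
    exact ((Commute.refl A).isUnit_mul_iff.1 h).1
  obtain ⟨U, hU⟩ := hAu
  have h := key K hK y
  rw [← hU] at h
  rw [← hU]
  exact (Units.isUnit_units_mul U _).1 h

lemma tendsto_pow_of_forall_mem_spectrum_norm_lt {R : Type*} [NormedRing R] [NormedAlgebra ℂ R]
    [CompleteSpace R] [Nontrivial R] (B : R) (hB : ∀ z ∈ spectrum ℂ B, ‖z‖ < 1) :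
    Filter.Tendsto (fun n : ℕ ↦ B ^ n) Filter.atTop (nhds 0) := by
  have h1 : spectralRadius ℂ B < 1 := by
    have := spectrum.spectralRadius_lt_of_forall_lt B (r := 1) (fun z hz ↦ hB z hz)
    simpa using this
  obtain ⟨r, hr1, hr2⟩ := ENNReal.lt_iff_exists_nnreal_btwn.1 h1
  have hr : r < 1 := by exact_mod_cast hr2
  have h2 := spectrum.pow_nnnorm_pow_one_div_tendsto_nhds_spectralRadius B
  have h3 := (h2.eventually (gt_mem_nhds hr1)).and (Filter.eventually_gt_atTop 0)
  refine squeeze_zero_norm' (h3.mono fun n ⟨hn, hn0⟩ ↦ ?_)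
    (tendsto_pow_atTop_nhds_zero_of_lt_one r.coe_nonneg (by exact_mod_cast hr))
  have hn' : (0 : ℝ) < n := by exact_mod_cast hn0
  have h4 : (‖B ^ n‖₊ : ENNReal) ≤ (r : ENNReal) ^ n := by
    have := ENNReal.rpow_le_rpow hn.le hn'.le
    rwa [← ENNReal.rpow_mul, one_div, inv_mul_cancel₀ hn'.ne', ENNReal.rpow_one,
      ENNReal.rpow_natCast] at this
  exact_mod_cast h4

/-- A part of the inertia theorem: if `A` is symmetric and bounded below by `δ`, and a perturbation
of size less than `δ` has its spectrum in the open right half-plane, then `A` is nonnegative. -/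
lemma re_inner_nonneg_of_spectrum_re_pos [Nontrivial H] (hA : A.IsSymmetric) (hκ : κ < δ)
    (hκ0 : 0 ≤ κ) (hAδ : ∀ x, δ * ‖x‖ ≤ ‖A x‖) (hK : ∀ x, ‖K x‖ ≤ κ * ‖x‖)
    (hspec : ∀ z ∈ spectrum ℂ (A + K), 0 < z.re) (x : H) : 0 ≤ (⟪A x, x⟫_ℂ).re := by
  set M := A + K with hM
  obtain ⟨w, hw, hwmin⟩ := (spectrum.isCompact M).exists_isMinOn (spectrum.nonempty M)
    Complex.continuous_re.continuousOn
  have hw0 := hspec w hw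
  set η := δ * (δ - κ)
  have hη : 0 < η := mul_pos (by linarith) (by linarith)
  obtain ⟨s, hs0, hs1, hs2⟩ :
      ∃ s : ℝ, 0 < s ∧ s * ‖M‖ ^ 2 < 2 * w.re ∧ s * (‖A‖ * ‖M‖ ^ 2) < 2 * η := by
    have hlim : ∀ c d : ℝ, 0 < d → ∀ᶠ s in nhdsWithin (0 : ℝ) (Set.Ioi 0), s * c < d := by
      intro c d hd
      have : Filter.Tendsto (fun s : ℝ ↦ s * c) (nhds 0) (nhds 0) := by
        simpa using (continuous_mul_const c).tendsto (0 : ℝ)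
      exact (this.mono_left nhdsWithin_le_nhds).eventually (gt_mem_nhds hd)
    obtain ⟨s, hs⟩ := ((hlim (‖M‖ ^ 2) (2 * w.re) (by linarith)).and
      ((hlim (‖A‖ * ‖M‖ ^ 2) (2 * η) (by linarith)).and self_mem_nhdsWithin)).exists
    exact ⟨s, hs.2.2, hs.1, hs.2.1⟩
  set B : H →L[ℂ] H := 1 - (s : ℂ) • M with hB
  have hBspec : ∀ z ∈ spectrum ℂ B, ‖z‖ < 1 := by
    intro z hz
    have hsu : (s : ℂ) ≠ 0 := by exact_mod_cast hs0.ne'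
    have h1 : ({1} : Set ℂ) - spectrum ℂ ((s : ℂ) • M) = spectrum ℂ B := by
      rw [spectrum.singleton_sub_eq, map_one]
    rw [← h1, spectrum.smul_eq_smul _ _ (spectrum.nonempty M)] at hz
    obtain ⟨_, rfl, _, ⟨v, hv, rfl⟩, rfl⟩ := hz
    have h2 : w.re ≤ v.re := hwmin hv
    have h3 : ‖v‖ ≤ ‖M‖ := spectrum.norm_le_norm_of_mem hv
    have h4 : ‖v‖ ^ 2 ≤ ‖M‖ ^ 2 := by gcongr
    have h5 : ‖1 - (s : ℂ) • v‖ ^ 2 = 1 - 2 * s * v.re + s ^ 2 * ‖v‖ ^ 2 := by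
      rw [← Complex.normSq_eq_norm_sq, ← Complex.normSq_eq_norm_sq, Complex.normSq_apply,
        Complex.normSq_apply]
      simp
      ring
    have h6 : ‖1 - (s : ℂ) • v‖ ^ 2 < 1 := by
      rw [h5]
      have : s * (s * ‖v‖ ^ 2) < s * (2 * v.re) := by
        apply mul_lt_mul_of_pos_left _ hs0
        nlinarith
      nlinarith
    exact (sq_lt_one_iff₀ (norm_nonneg _)).1 h6
  have hlim := tendsto_pow_of_forall_mem_spectrum_norm_lt B hBspec
  have hstep : ∀ y, (⟪A (B y), B y⟫_ℂ).re ≤ (⟪A y, y⟫_ℂ).re := by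
    intro y
    have h1 := re_inner_perturbed_ge hκ hAδ hK y
    rw [← hM] at h1
    have h2 : (⟪A (M y), y⟫_ℂ).re = (⟪A y, M y⟫_ℂ).re := by
      rw [show ⟪A (M y), y⟫_ℂ = ⟪M y, A y⟫_ℂ from hA _ _, ← inner_conj_symm, Complex.conj_re]
    have h3 : (⟪A (B y), B y⟫_ℂ).re = (⟪A y, y⟫_ℂ).re - 2 * s * (⟪A y, M y⟫_ℂ).re
        + s ^ 2 * (⟪A (M y), M y⟫_ℂ).re := by
      have : B y = y - (s : ℂ) • M y := by simp [hB]
      rw [this, map_sub, map_smul]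
      simp only [inner_sub_left, inner_sub_right, inner_smul_left, inner_smul_right,
        Complex.conj_ofReal, Complex.sub_re, Complex.re_ofReal_mul, h2]
      ring
    have h4 : (⟪A (M y), M y⟫_ℂ).re ≤ ‖A‖ * ‖M‖ ^ 2 * ‖y‖ ^ 2 := by
      calc _ ≤ ‖A (M y)‖ * ‖M y‖ := (Complex.re_le_norm _).trans (norm_inner_le_norm _ _)
        _ ≤ (‖A‖ * (‖M‖ * ‖y‖)) * (‖M‖ * ‖y‖) := by
          gcongr
          · exact (A.le_opNorm _).trans (by gcongr; exact M.le_opNorm _)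
          · exact M.le_opNorm _
        _ = _ := by ring
    rw [h3]
    have h5 : s * (s * (⟪A (M y), M y⟫_ℂ).re) ≤ s * (2 * (⟪A y, M y⟫_ℂ).re) := by
      apply mul_le_mul_of_nonneg_left _ hs0.le
      calc s * (⟪A (M y), M y⟫_ℂ).re ≤ s * (‖A‖ * ‖M‖ ^ 2 * ‖y‖ ^ 2) := by gcongr
        _ = s * (‖A‖ * ‖M‖ ^ 2) * ‖y‖ ^ 2 := by ring
        _ ≤ 2 * η * ‖y‖ ^ 2 := by gcongr
        _ ≤ _ := by linarith
    nlinarith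
  have hle : ∀ n : ℕ, (⟪A ((B ^ n) x), (B ^ n) x⟫_ℂ).re ≤ (⟪A x, x⟫_ℂ).re := by
    intro n
    induction n with
    | zero => simp
    | succ n ih => rw [pow_succ']; exact (hstep _).trans ih
  have hcont : Continuous fun C : H →L[ℂ] H ↦ (⟪A (C x), C x⟫_ℂ).re := by fun_prop
  have h0 := (hcont.tendsto 0).comp hlim
  simp only [zero_apply, map_zero, inner_zero_left, Complex.zero_re] at h0
  exact le_of_tendsto h0 (Filter.Eventually.of_forall hle)

/-- A gap of a symmetric operator of half-width larger than `ε + κ`, with spectrum on both sides,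
disconnects the `ε`-pseudospectrum of every perturbation of size at most `κ`. -/
lemma not_isPathConnected_pseudospectrum [Nontrivial H] {S : H →L[ℂ] H} (hS : S.IsSymmetric)
    {ε e : ℝ} (hε : 0 < ε) (hκ0 : 0 ≤ κ) (hδ : ε + κ < δ)
    (hSδ : ∀ x, δ * ‖x‖ ≤ ‖S x - (e : ℂ) • x‖) (hK : ∀ x, ‖K x‖ ≤ κ * ‖x‖)
    {x₁ x₂ : H} (h₁ : (⟪S x₁ - (e : ℂ) • x₁, x₁⟫_ℂ).re < 0)
    (h₂ : 0 < (⟪S x₂ - (e : ℂ) • x₂, x₂⟫_ℂ).re) :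
    ¬ IsPathConnected (pseudospectrum ε (S + K)) := by
  intro hconn
  set A : H →L[ℂ] H := S - (e : ℂ) • 1 with hAdef
  have hAx : ∀ x, A x = S x - (e : ℂ) • x := fun x ↦ by simp [hAdef]
  have hA : A.IsSymmetric := by
    intro x y
    change ⟪A x, y⟫_ℂ = ⟪x, A y⟫_ℂ
    rw [hAx, hAx, inner_sub_left, inner_sub_right, inner_smul_left, inner_smul_right,
      Complex.conj_ofReal, show ⟪S x, y⟫_ℂ = ⟪x, S y⟫_ℂ from hS x y]
  have hAδ : ∀ x, δ * ‖x‖ ≤ ‖A x‖ := fun x ↦ by rw [hAx]; exact hSδ x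
  have hκδ : κ < δ := by linarith
  have hshift : ∀ z : ℂ, algebraMap ℂ (H →L[ℂ] H) (z + e) - (S + K)
      = algebraMap ℂ (H →L[ℂ] H) z - (A + K) := by
    intro z
    rw [hAdef, map_add, Algebra.algebraMap_eq_smul_one (e : ℂ)]
    abel
  have hmem : ∀ z ∈ spectrum ℂ (A + K), z + e ∈ pseudospectrum ε (S + K) := by
    intro z hz
    left
    rw [spectrum.mem_iff, hshift]
    exact spectrum.mem_iff.1 hz
  have hleft : ∃ z ∈ pseudospectrum ε (S + K), z.re ≤ e := by
    by_contra! hcon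
    refine h₁.not_ge ?_
    rw [← hAx]
    refine re_inner_nonneg_of_spectrum_re_pos hA hκδ hκ0 hAδ hK (fun z hz ↦ ?_) x₁
    have := hcon _ (hmem z hz)
    simpa using this
  have hright : ∃ z ∈ pseudospectrum ε (S + K), e ≤ z.re := by
    by_contra! hcon
    refine h₂.not_ge ?_
    rw [← hAx]
    have hA' : (-A).IsSymmetric := by
      intro x y
      change ⟪-A x, y⟫_ℂ = ⟪x, -A y⟫_ℂ
      rw [inner_neg_left, inner_neg_right, show ⟪A x, y⟫_ℂ = ⟪x, A y⟫_ℂ from hA x y]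
    have h := re_inner_nonneg_of_spectrum_re_pos (K := -K) hA' hκδ hκ0
      (fun x ↦ by simpa using hAδ x) (fun x ↦ by simpa using hK x) (fun z hz ↦ ?_) x₂
    · simpa using h
    · rw [← neg_add, ← spectrum.neg_eq] at hz
      have := hcon _ (hmem _ hz)
      simpa using this
  obtain ⟨z₁, hz₁, hz₁e⟩ := hleft
  obtain ⟨z₂, hz₂, hz₂e⟩ := hright
  obtain ⟨w, hw, hwe⟩ := hconn.isConnected.isPreconnected.intermediate_value hz₁ hz₂
    Complex.continuous_re.continuousOn ⟨hz₁e, hz₂e⟩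
  have hwI : w = (w.im : ℂ) * Complex.I + e := by
    apply Complex.ext <;> simp [hwe]
  obtain ⟨U, hU⟩ := isUnit_perturbed hA hκδ hκ0 hAδ hK w.im
  have hUw : algebraMap ℂ (H →L[ℂ] H) w - (S + K) = ((-U : (H →L[ℂ] H)ˣ) : H →L[ℂ] H) := by
    rw [hwI, hshift, Units.val_neg, hU]
    simp
  rcases hw with hw | hw
  · refine spectrum.mem_iff.1 hw ?_
    rw [hUw]
    exact Units.isUnit _
  · rw [hUw, Ring.inverse_unit] at hw
    have hnorm : ‖((-U)⁻¹ : (H →L[ℂ] H)ˣ).val‖ ≤ (δ - κ)⁻¹ := by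
      refine ContinuousLinearMap.opNorm_le_bound _ (inv_nonneg.2 (by linarith)) fun x ↦ ?_
      have h := norm_le_perturbed hA hAδ hK w.im (((-U)⁻¹ : (H →L[ℂ] H)ˣ).val x)
      rw [← hU] at h
      have hx : ‖U.val (((-U)⁻¹ : (H →L[ℂ] H)ˣ).val x)‖ = ‖x‖ := by
        have : (-U).val (((-U)⁻¹ : (H →L[ℂ] H)ˣ).val x) = x := by
          change ((-U).val * ((-U)⁻¹ : (H →L[ℂ] H)ˣ).val) x = x
          rw [Units.mul_inv]
          rfl
        conv_rhs => rw [← this]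
        rw [Units.val_neg, neg_apply, norm_neg]
      rw [hx] at h
      rw [inv_mul_eq_div, le_div_iff₀' (by linarith)]
      exact h
    have : (δ - κ)⁻¹ < ε⁻¹ := inv_strictAnti₀ hε (by linarith)
    linarith

end GappedPerturbation

section SpectralSubspace

variable {E : Type*} [NormedAddCommGroup E] [InnerProductSpace ℂ E] [FiniteDimensional ℂ E]

/-- The span of the eigenvectors of a symmetric operator indexed by `S`. -/
lemma LinearMap.IsSymmetric.exists_submodule_of_finset {T : E →ₗ[ℂ] E} (hT : T.IsSymmetric)
    {q : ℕ} (hq : Module.finrank ℂ E = q) (S : Finset (Fin q)) :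
    ∃ W : Submodule ℂ E, Module.finrank ℂ W = S.card ∧ ∀ y ∈ W, ∃ w : Fin q → ℝ,
      (∀ i, 0 ≤ w i) ∧ ‖y‖ ^ 2 = ∑ i ∈ S, w i ∧
      (⟪T y, y⟫_ℂ).re = ∑ i ∈ S, hT.eigenvalues hq i * w i := by
  set e := hT.eigenvectorBasis hq
  refine ⟨Submodule.span ℂ (Set.range fun i : S ↦ e i), ?_, fun y hy ↦
    ⟨fun i ↦ ‖⟪e i, y⟫_ℂ‖ ^ 2, fun i ↦ by positivity, ?_⟩⟩
  · exact (finrank_span_eq_card (b := fun i : S ↦ e i)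
      (e.orthonormal.linearIndependent.comp _ Subtype.val_injective)).trans (Fintype.card_coe S)
  have hzero : ∀ i ∉ S, ⟪e i, y⟫_ℂ = 0 := by
    intro i hi
    induction hy using Submodule.span_induction with
    | mem x hx =>
      obtain ⟨l, rfl⟩ := hx
      exact e.orthonormal.2 fun h ↦ hi (h ▸ l.2)
    | zero => simp
    | add x z _ _ hx hz => rw [inner_add_right, hx, hz, add_zero]
    | smul c x _ hx => rw [inner_smul_right, hx, mul_zero]
  have hTe : ∀ i, ⟪T y, e i⟫_ℂ = hT.eigenvalues hq i * ⟪y, e i⟫_ℂ := by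
    intro i
    rw [hT y, hT.apply_eigenvectorBasis, inner_smul_right]
    rfl
  constructor
  · rw [← e.sum_sq_norm_inner_right y]
    refine (Finset.sum_subset (Finset.subset_univ S) fun i _ hi ↦ ?_).symm
    simp [hzero i hi]
  · rw [← e.sum_inner_mul_inner (T y) y, Complex.re_sum]
    have hterm : ∀ i, (⟪T y, e i⟫_ℂ * ⟪e i, y⟫_ℂ).re
        = hT.eigenvalues hq i * ‖⟪e i, y⟫_ℂ‖ ^ 2 := by
      intro i
      rw [hTe, mul_assoc, Complex.re_ofReal_mul, ← inner_conj_symm,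
        ← Complex.normSq_eq_conj_mul_self, Complex.ofReal_re, Complex.normSq_eq_norm_sq]
    simp only [hterm]
    refine (Finset.sum_subset (Finset.subset_univ S) fun i _ hi ↦ ?_).symm
    simp [hzero i hi]

lemma LinearMap.IsSymmetric.exists_submodule_ge {T : E →ₗ[ℂ] E} (hT : T.IsSymmetric)
    {q : ℕ} (hq : Module.finrank ℂ E = q) (m : Fin q) :
    ∃ W : Submodule ℂ E, Module.finrank ℂ W = m + 1 ∧
      ∀ y ∈ W, hT.eigenvalues hq m * ‖y‖ ^ 2 ≤ (⟪T y, y⟫_ℂ).re := by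
  obtain ⟨W, hW, h⟩ := hT.exists_submodule_of_finset hq (Finset.Iic m)
  refine ⟨W, by rw [hW, Fin.card_Iic], fun y hy ↦ ?_⟩
  obtain ⟨w, hw, h1, h2⟩ := h y hy
  rw [h1, h2, Finset.mul_sum]
  exact Finset.sum_le_sum fun i hi ↦ mul_le_mul_of_nonneg_right
    (hT.eigenvalues_antitone hq (Finset.mem_Iic.1 hi)) (hw i)

lemma LinearMap.IsSymmetric.exists_submodule_le {T : E →ₗ[ℂ] E} (hT : T.IsSymmetric)
    {q : ℕ} (hq : Module.finrank ℂ E = q) (m : Fin q) :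
    ∃ W : Submodule ℂ E, Module.finrank ℂ W = q - m ∧
      ∀ y ∈ W, (⟪T y, y⟫_ℂ).re ≤ hT.eigenvalues hq m * ‖y‖ ^ 2 := by
  obtain ⟨W, hW, h⟩ := hT.exists_submodule_of_finset hq (Finset.Ici m)
  refine ⟨W, by rw [hW, Fin.card_Ici], fun y hy ↦ ?_⟩
  obtain ⟨w, hw, h1, h2⟩ := h y hy
  rw [h1, h2, Finset.mul_sum]
  exact Finset.sum_le_sum fun i hi ↦ mul_le_mul_of_nonneg_right
    (hT.eigenvalues_antitone hq (Finset.mem_Ici.1 hi)) (hw i)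

end SpectralSubspace

section Dirichlet

variable {q : ℕ}

/-- The extension by zero of a vector `y` from the sites `1, …, q` to `ℤ`, evaluated at `k`. -/
noncomputable def zeroExtend (k : ℤ) : EuclideanSpace ℂ (Fin q) →ₗ[ℂ] ℂ where
  toFun y := if h : 1 ≤ k ∧ k ≤ q then y ⟨(k - 1).toNat, by omega⟩ else 0
  map_add' x y := by split_ifs <;> simp
  map_smul' c y := by split_ifs <;> simp

lemma zeroExtend_succ (y : EuclideanSpace ℂ (Fin q)) (r : Fin q) :
    zeroExtend ((r : ℤ) + 1) y = y r := by
  have h : 1 ≤ (r : ℤ) + 1 ∧ (r : ℤ) + 1 ≤ q := by omega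
  simp [zeroExtend, h]

lemma zeroExtend_eq_zero {k : ℤ} (hk : k ≤ 0 ∨ (q : ℤ) < k) (y : EuclideanSpace ℂ (Fin q)) :
    zeroExtend k y = 0 := by
  have h : ¬ (1 ≤ k ∧ k ≤ q) := by omega
  simp [zeroExtend, h]

/-- The Dirichlet restriction of the symmetric Jacobi operator with diagonal `a` and off-diagonal
`b` to the sites `j + 1, …, j + q`. -/
noncomputable def dirichletJacobi (q : ℕ) (a b : ℤ → ℝ) (j : ℤ) :
    EuclideanSpace ℂ (Fin q) →ₗ[ℂ] EuclideanSpace ℂ (Fin q) where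
  toFun y := WithLp.toLp 2 fun r ↦ (b (j + r) : ℂ) * zeroExtend (r : ℤ) y
    + (a (j + r + 1) : ℂ) * y r + (b (j + r + 1) : ℂ) * zeroExtend ((r : ℤ) + 2) y
  map_add' x y := by ext r; simp; ring
  map_smul' c y := by ext r; simp; ring

/-- The symmetric Jacobi operator on `ℤ/L` with diagonal `α` and off-diagonal `β`. -/
noncomputable def cyclicJacobi {L : ℕ} [NeZero L] (α β : ZMod L → ℝ) :
    EuclideanSpace ℂ (ZMod L) →ₗ[ℂ] EuclideanSpace ℂ (ZMod L) where
  toFun x := WithLp.toLp 2 fun n ↦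
    (β (n - 1) : ℂ) * x (n - 1) + (α n : ℂ) * x n + (β n : ℂ) * x (n + 1)
  map_add' x y := by ext r; simp; ring
  map_smul' c y := by ext r; simp; ring

lemma cyclicJacobi_isSymmetric {L : ℕ} [NeZero L] (α β : ZMod L → ℝ) :
    (cyclicJacobi α β).IsSymmetric := by
  intro x y
  simp only [PiLp.inner_apply, cyclicJacobi, LinearMap.coe_mk, AddHom.coe_mk, inner_add_left,
    inner_add_right, Finset.sum_add_distrib]
  have h1 : ∀ u v : EuclideanSpace ℂ (ZMod L),
      ∑ n, ⟪(β (n - 1) : ℂ) * u (n - 1), v n⟫_ℂ = ∑ n, ⟪u n, (β n : ℂ) * v (n + 1)⟫_ℂ := by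
    intro u v
    rw [← Equiv.sum_comp (Equiv.addRight (1 : ZMod L))]
    refine Finset.sum_congr rfl fun n _ ↦ ?_
    simp
    ring
  have h2 : ∑ n, ⟪(β n : ℂ) * x (n + 1), y n⟫_ℂ = ∑ n, ⟪x n, (β (n - 1) : ℂ) * y (n - 1)⟫_ℂ := by
    rw [← Equiv.sum_comp (Equiv.addRight (1 : ZMod L))
      (fun n ↦ ⟪x n, (β (n - 1) : ℂ) * y (n - 1)⟫_ℂ)]
    refine Finset.sum_congr rfl fun n _ ↦ ?_
    simp
    ring
  have h3 : ∑ n, ⟪(α n : ℂ) * x n, y n⟫_ℂ = ∑ n, ⟪x n, (α n : ℂ) * y n⟫_ℂ := by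
    refine Finset.sum_congr rfl fun n _ ↦ ?_
    simp
    ring
  rw [h1, h2, h3]
  ring

lemma ZMod.sum_eq_sum_range {L : ℕ} [NeZero L] {M : Type*} [AddCommMonoid M] (F : ZMod L → M) :
    ∑ n, F n = ∑ v ∈ Finset.range L, F (v : ZMod L) := by
  refine Finset.sum_nbij' (fun n ↦ n.val) (fun v ↦ (v : ZMod L)) ?_ ?_ ?_ ?_ ?_
  · intro n _; exact Finset.mem_range.2 n.val_lt
  · intro _ _; exact Finset.mem_univ _
  · intro n _; exact ZMod.natCast_zmod_val n
  · intro v hv; exact ZMod.val_natCast_of_lt (Finset.mem_range.1 hv)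
  · intro n _; rw [ZMod.natCast_zmod_val]

lemma ZMod.sum_eq_sum_blocks {N p : ℕ} [NeZero (N * p)] {M : Type*} [AddCommMonoid M]
    (F : ZMod (N * p) → M) (j : ZMod (N * p)) :
    ∑ n, F n = ∑ B : Fin N, ∑ k : Fin p, F (j + ((k + p * B : ℕ) : ZMod (N * p))) := by
  rw [← Equiv.sum_comp (Equiv.addLeft j), ZMod.sum_eq_sum_range, Finset.sum_range,
    ← finProdFinEquiv.sum_comp, Fintype.sum_prod_type]
  rfl

/-- Vectors on the `N` blocks `j + B * (q + 1) + {1, …, q}` of `ℤ/(N * (q + 1))`, extended by zero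
to the remaining sites. -/
noncomputable def blockEmbed (N q : ℕ) [NeZero (N * (q + 1))] (j : ZMod (N * (q + 1))) :
    (Fin N → EuclideanSpace ℂ (Fin q)) →ₗ[ℂ] EuclideanSpace ℂ (ZMod (N * (q + 1))) where
  toFun Y := WithLp.toLp 2 fun n ↦ zeroExtend (((n - j).val % (q + 1) : ℕ) : ℤ)
    (Y ⟨(n - j).val / (q + 1), Nat.div_lt_of_lt_mul ((ZMod.val_lt _).trans_eq (mul_comm _ _))⟩)
  map_add' x y := by ext n; simp
  map_smul' c y := by ext n; simp

variable {N : ℕ} [NeZero (N * (q + 1))]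

lemma blockEmbed_apply (j : ZMod (N * (q + 1))) (Y : Fin N → EuclideanSpace ℂ (Fin q))
    (B : Fin N) {k : ℕ} (hk : k ≤ q + 1) :
    blockEmbed N q j Y (j + ((k + (q + 1) * B : ℕ) : ZMod (N * (q + 1)))) = zeroExtend k (Y B) := by
  have hB : (q + 1) * (B + 1 : ℕ) ≤ N * (q + 1) := by
    rw [mul_comm N]
    exact Nat.mul_le_mul_left _ B.2
  rcases hk.lt_or_eq with hk | rfl
  · have hval : (((k + (q + 1) * B : ℕ) : ZMod (N * (q + 1)))).val = k + (q + 1) * B :=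
      ZMod.val_natCast_of_lt (by rw [mul_add] at hB; omega)
    have hdiv : (k + (q + 1) * B) / (q + 1) = B := by
      rw [Nat.add_mul_div_left _ _ (Nat.succ_pos q), Nat.div_eq_of_lt hk, zero_add]
    have hmod : (k + (q + 1) * B) % (q + 1) = k := by
      rw [Nat.add_mul_mod_self_left, Nat.mod_eq_of_lt hk]
    simp only [blockEmbed, LinearMap.coe_mk, AddHom.coe_mk, add_sub_cancel_left, hval, hdiv, hmod]
  · have hmod : (((q + 1 + (q + 1) * B : ℕ) : ZMod (N * (q + 1)))).val % (q + 1) = 0 := by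
      rw [ZMod.val_natCast, Nat.mod_mul_left_mod, Nat.add_mul_mod_self_left, Nat.mod_self]
    simp only [blockEmbed, LinearMap.coe_mk, AddHom.coe_mk, add_sub_cancel_left, hmod]
    rw [zeroExtend_eq_zero (Or.inl (by simp)), zeroExtend_eq_zero (Or.inr (by push_cast; omega))]

lemma inner_blockEmbed_eq_sum (j : ZMod (N * (q + 1))) (Y : Fin N → EuclideanSpace ℂ (Fin q))
    (x : EuclideanSpace ℂ (ZMod (N * (q + 1)))) :
    ⟪blockEmbed N q j Y, x⟫_ℂ = ∑ B : Fin N, ∑ r : Fin q,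
      ⟪Y B r, x (j + ((r + 1 + (q + 1) * B : ℕ) : ZMod (N * (q + 1))))⟫_ℂ := by
  rw [PiLp.inner_apply, ZMod.sum_eq_sum_blocks _ j]
  refine Finset.sum_congr rfl fun B _ ↦ ?_
  rw [Fin.sum_univ_succ, blockEmbed_apply j Y B (by simp), Fin.val_zero,
    zeroExtend_eq_zero (Or.inl (by simp)), inner_zero_left, zero_add]
  refine Finset.sum_congr rfl fun r _ ↦ ?_
  rw [blockEmbed_apply j Y B r.succ.2.le, Fin.val_succ, Nat.cast_succ, zeroExtend_succ]

lemma inner_blockEmbed_blockEmbed (j : ZMod (N * (q + 1)))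
    (Y Z : Fin N → EuclideanSpace ℂ (Fin q)) :
    ⟪blockEmbed N q j Y, blockEmbed N q j Z⟫_ℂ = ∑ B, ⟪Y B, Z B⟫_ℂ := by
  rw [inner_blockEmbed_eq_sum]
  refine Finset.sum_congr rfl fun B _ ↦ ?_
  rw [PiLp.inner_apply]
  refine Finset.sum_congr rfl fun r _ ↦ ?_
  rw [blockEmbed_apply j Z B (k := r + 1) (by omega), Nat.cast_succ, zeroExtend_succ]

lemma norm_sq_blockEmbed (j : ZMod (N * (q + 1))) (Y : Fin N → EuclideanSpace ℂ (Fin q)) :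
    ‖blockEmbed N q j Y‖ ^ 2 = ∑ B, ‖Y B‖ ^ 2 := by
  have h := congrArg Complex.re (inner_blockEmbed_blockEmbed j Y Y)
  rw [Complex.re_sum] at h
  simpa only [← RCLike.re_to_complex, inner_self_eq_norm_sq] using h

lemma blockEmbed_injective (j : ZMod (N * (q + 1))) : Function.Injective (blockEmbed N q j) := by
  rw [injective_iff_map_eq_zero]
  intro Y hY
  have h := norm_sq_blockEmbed j Y
  rw [hY, norm_zero, zero_pow two_ne_zero, eq_comm,
    Finset.sum_eq_zero_iff_of_nonneg fun B _ ↦ by positivity] at h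
  ext1 B
  simpa using h B (Finset.mem_univ B)

variable {a b : ℤ → ℝ} {α β : ZMod (N * (q + 1)) → ℝ}

lemma inner_blockEmbed_cyclicJacobi (ha : ∀ n : ℤ, a (n + (q + 1 : ℕ)) = a n)
    (hb : ∀ n : ℤ, b (n + (q + 1 : ℕ)) = b n)
    (hα : ∀ n : ℤ, α n = a n) (hβ : ∀ n : ℤ, β n = b n)
    (j : ℤ) (Y Z : Fin N → EuclideanSpace ℂ (Fin q)) :
    ⟪blockEmbed N q j Y, cyclicJacobi α β (blockEmbed N q j Z)⟫_ℂ
      = ∑ B, ⟪Y B, dirichletJacobi q a b j (Z B)⟫_ℂ := by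
  have hper : ∀ {f : ℤ → ℝ} {φ : ZMod (N * (q + 1)) → ℝ}, (∀ n : ℤ, f (n + (q + 1 : ℕ)) = f n) →
      (∀ n : ℤ, φ n = f n) → ∀ k B : ℕ,
      φ ((j : ZMod (N * (q + 1))) + ((k + (q + 1) * B : ℕ) : ZMod (N * (q + 1)))) = f (j + k) := by
    intro f φ hf hφ k B
    rw [← Function.Periodic.int_mul (f := f) (c := ((q + 1 : ℕ) : ℤ)) hf B (j + k), ← hφ]
    congr 1
    push_cast
    ring
  rw [inner_blockEmbed_eq_sum]
  refine Finset.sum_congr rfl fun B _ ↦ ?_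
  rw [PiLp.inner_apply]
  refine Finset.sum_congr rfl fun r _ ↦ ?_
  congr 1
  have hpred : (j : ZMod (N * (q + 1))) + ((r + 1 + (q + 1) * B : ℕ) : ZMod (N * (q + 1))) - 1
      = j + ((r + (q + 1) * B : ℕ) : ZMod (N * (q + 1))) := by
    push_cast
    ring
  have hsucc : (j : ZMod (N * (q + 1))) + ((r + 1 + (q + 1) * B : ℕ) : ZMod (N * (q + 1))) + 1
      = j + ((r + 2 + (q + 1) * B : ℕ) : ZMod (N * (q + 1))) := by
    push_cast
    ring
  simp only [cyclicJacobi, dirichletJacobi, LinearMap.coe_mk, AddHom.coe_mk]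
  rw [hpred, hsucc, hper hb hβ, hper hb hβ, hper ha hα, blockEmbed_apply _ _ _ (by omega),
    blockEmbed_apply _ _ _ (by omega), blockEmbed_apply _ _ _ (by omega)]
  push_cast
  rw [zeroExtend_succ, add_assoc j]

lemma exists_zmod_lift {f : ℤ → ℝ} {p : ℕ} (hf : ∀ n : ℤ, f (n + p) = f n) (N : ℕ)
    [NeZero (N * p)] : ∃ φ : ZMod (N * p) → ℝ, ∀ n : ℤ, φ n = f n := by
  refine ⟨fun n ↦ f n.val, fun n ↦ ?_⟩
  have h := (Function.Periodic.int_mul (f := f) (c := (p : ℤ)) hf (N * (n / (N * p : ℕ))))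
    ((n : ZMod (N * p)).val)
  change f ((n : ZMod (N * p)).val) = f n
  rw [← h, ZMod.val_intCast]
  congr 1
  push_cast
  linarith [Int.emod_add_mul_ediv n (N * p)]

lemma dirichletJacobi_isSymmetric (ha : ∀ n : ℤ, a (n + (q + 1 : ℕ)) = a n)
    (hb : ∀ n : ℤ, b (n + (q + 1 : ℕ)) = b n) (j : ℤ) : (dirichletJacobi q a b j).IsSymmetric := by
  have : NeZero (1 * (q + 1)) := ⟨by simp⟩
  obtain ⟨α, hα⟩ := exists_zmod_lift ha 1
  obtain ⟨β, hβ⟩ := exists_zmod_lift hb 1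
  intro y z
  have h := cyclicJacobi_isSymmetric α β (blockEmbed 1 q j fun _ ↦ y) (blockEmbed 1 q j fun _ ↦ z)
  rw [← inner_conj_symm, inner_blockEmbed_cyclicJacobi ha hb hα hβ,
    inner_blockEmbed_cyclicJacobi ha hb hα hβ] at h
  simpa using h

/-- An interval between two Dirichlet eigenvalues of the same index lies in a spectral gap of the
cyclic operator. -/
lemma norm_le_norm_cyclicJacobi_sub (ha : ∀ n : ℤ, a (n + (q + 1 : ℕ)) = a n)
    (hb : ∀ n : ℤ, b (n + (q + 1 : ℕ)) = b n)
    (hα : ∀ n : ℤ, α n = a n) (hβ : ∀ n : ℤ, β n = b n) {i j : ℤ} (m : Fin q) {μ ν : ℝ}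
    (hν : (dirichletJacobi_isSymmetric ha hb i).eigenvalues finrank_euclideanSpace_fin m = ν)
    (hμ : (dirichletJacobi_isSymmetric ha hb j).eigenvalues finrank_euclideanSpace_fin m = μ)
    (hνμ : ν < μ) (x : EuclideanSpace ℂ (ZMod (N * (q + 1)))) :
    (μ - ν) / 2 * ‖x‖ ≤ ‖cyclicJacobi α β x - (((μ + ν) / 2 : ℝ) : ℂ) • x‖ := by
  obtain ⟨V, hV, hVle⟩ :=
    (dirichletJacobi_isSymmetric ha hb i).exists_submodule_le finrank_euclideanSpace_fin m
  obtain ⟨W, hW, hWge⟩ :=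
    (dirichletJacobi_isSymmetric ha hb j).exists_submodule_ge finrank_euclideanSpace_fin m
  rw [hν] at hVle
  rw [hμ] at hWge
  set T : EuclideanSpace ℂ (ZMod (N * (q + 1))) →ₗ[ℂ] EuclideanSpace ℂ (ZMod (N * (q + 1))) :=
    cyclicJacobi α β - (((μ + ν) / 2 : ℝ) : ℂ) • LinearMap.id with hTdef
  have hT : T.IsSymmetric :=
    (cyclicJacobi_isSymmetric α β).sub (LinearMap.IsSymmetric.id.smul (Complex.conj_ofReal _))
  have hquad : ∀ (l : ℤ) (Y : Fin N → EuclideanSpace ℂ (Fin q)),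
      (⟪T (blockEmbed N q l Y), blockEmbed N q l Y⟫_ℂ).re
        = ∑ B, (⟪dirichletJacobi q a b l (Y B), Y B⟫_ℂ).re - (μ + ν) / 2 * ∑ B, ‖Y B‖ ^ 2 := by
    intro l Y
    rw [← norm_sq_blockEmbed (l : ZMod (N * (q + 1)))]
    simp only [hTdef, LinearMap.sub_apply, LinearMap.smul_apply, LinearMap.id_apply,
      inner_sub_left, inner_smul_left, Complex.conj_ofReal, Complex.sub_re,
      Complex.re_ofReal_mul, ← @inner_self_eq_norm_sq ℂ, RCLike.re_to_complex]
    rw [← inner_conj_symm, Complex.conj_re, inner_blockEmbed_cyclicJacobi ha hb hα hβ,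
      Complex.re_sum]
    congr 1
    refine Finset.sum_congr rfl fun B _ ↦ ?_
    rw [← inner_conj_symm, Complex.conj_re]
  have h := hT.norm_le_of_definite_of_finrank_add
    (f := blockEmbed N q i ∘ₗ V.subtype.compLeft (Fin N))
    (g := blockEmbed N q j ∘ₗ W.subtype.compLeft (Fin N))
    ((blockEmbed_injective _).comp (Subtype.val_injective.comp_left))
    ((blockEmbed_injective _).comp (Subtype.val_injective.comp_left))
    (by
      rw [Module.finrank_pi_fintype, Module.finrank_pi_fintype, finrank_euclideanSpace, ZMod.card]
      simp only [hV, hW, Finset.sum_const, Finset.card_univ, Fintype.card_fin, smul_eq_mul]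
      rw [← mul_add]
      congr 1
      omega)
    (half_pos (sub_pos.2 hνμ))
    (fun Y ↦ by
      rw [LinearMap.comp_apply, hquad, norm_sq_blockEmbed]
      have := Finset.sum_le_sum fun B (_ : B ∈ Finset.univ) ↦ hVle (Y B) (Y B).2
      rw [← Finset.mul_sum] at this
      simp only [LinearMap.compLeft_apply, Function.comp_apply, Submodule.subtype_apply]
      linarith)
    (fun Y ↦ by
      rw [LinearMap.comp_apply, hquad, norm_sq_blockEmbed]
      have := Finset.sum_le_sum fun B (_ : B ∈ Finset.univ) ↦ hWge (Y B) (Y B).2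
      rw [← Finset.mul_sum] at this
      simp only [LinearMap.compLeft_apply, Function.comp_apply, Submodule.subtype_apply]
      linarith) x
  simpa [hTdef] using h

lemma sum_eigenvalues_dirichletJacobi (ha : ∀ n : ℤ, a (n + (q + 1 : ℕ)) = a n)
    (hb : ∀ n : ℤ, b (n + (q + 1 : ℕ)) = b n) (j : ℤ) :
    ∑ m, (dirichletJacobi_isSymmetric ha hb j).eigenvalues finrank_euclideanSpace_fin m
      = ∑ r ∈ Finset.range (q + 1), a r - a j := by
  have hper : ∀ j : ℤ, ∑ r ∈ Finset.range (q + 1), a (j + r) = ∑ r ∈ Finset.range (q + 1), a r := by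
    have hstep : ∀ j : ℤ, ∑ r ∈ Finset.range (q + 1), a (j + 1 + r)
        = ∑ r ∈ Finset.range (q + 1), a (j + r) := by
      intro j
      have h1 := Finset.sum_range_succ (fun r : ℕ ↦ a (j + r)) (q + 1)
      have h2 := Finset.sum_range_succ' (fun r : ℕ ↦ a (j + r)) (q + 1)
      rw [ha] at h1
      have h3 : ∀ r : ℕ, a (j + 1 + r) = a (j + (r + 1 : ℕ)) := fun r ↦ by
        push_cast; congr 1; ring
      simp only [h3]
      simp only [Nat.cast_zero, add_zero] at h2
      linarith
    intro j
    induction j using Int.induction_on with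
    | zero => simp
    | succ j ih => rw [hstep, ih]
    | pred j ih => rw [← hstep, sub_add_cancel, ih]
  rw [← LinearMap.IsSymmetric.re_trace_eq_sum_eigenvalues, LinearMap.trace_eq_sum_inner _
    (EuclideanSpace.basisFun (Fin q) ℂ), ← hper j, Finset.sum_range_succ', Nat.cast_zero, add_zero,
    add_sub_cancel_right, Finset.sum_range, map_sum]
  refine Finset.sum_congr rfl fun r _ ↦ ?_
  rw [EuclideanSpace.basisFun_inner]
  have h0 : ∀ k : ℤ, k ≠ r + 1 → zeroExtend k (EuclideanSpace.basisFun (Fin q) ℂ r) = 0 := by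
    intro k hk
    by_cases h : 1 ≤ k ∧ k ≤ q
    · obtain ⟨s, rfl⟩ : ∃ s : Fin q, k = s + 1 := ⟨⟨(k - 1).toNat, by omega⟩, by simp; omega⟩
      rw [zeroExtend_succ]
      have : s ≠ r := by rintro rfl; exact hk rfl
      simp [this]
    · exact zeroExtend_eq_zero (by omega) _
  simp only [dirichletJacobi, LinearMap.coe_mk, AddHom.coe_mk]
  rw [h0 r (by omega), h0 (r + 2) (by omega)]
  simp [add_assoc]

end Dirichlet

section BiInfinite

lemma lp.hasSum_norm_sq {ι : Type*} (u : lp (fun _ : ι ↦ ℂ) 2) :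
    HasSum (fun n ↦ ‖u n‖ ^ 2) (‖u‖ ^ 2) := by
  simpa using lp.hasSum_norm (p := 2) (by simp) u

lemma exists_rightShift : ∃ R : lp (fun _ : ℤ ↦ ℂ) 2 →L[ℂ] lp (fun _ : ℤ ↦ ℂ) 2,
    (∀ u n, R u n = u (n - 1)) ∧ ∀ u, ‖R u‖ = ‖u‖ := by
  have hmem : ∀ u : lp (fun _ : ℤ ↦ ℂ) 2, Memℓp (fun n : ℤ ↦ u (n - 1)) 2 := by
    intro u
    refine memℓp_gen ?_
    have h := (lp.memℓp u).summable (by simp)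
    exact h.comp_injective (sub_left_injective (b := (1 : ℤ)))
  let R : lp (fun _ : ℤ ↦ ℂ) 2 →ₗ[ℂ] lp (fun _ : ℤ ↦ ℂ) 2 :=
    { toFun := fun u ↦ ⟨fun n ↦ u (n - 1), hmem u⟩
      map_add' := fun u v ↦ by ext n; rfl
      map_smul' := fun c u ↦ by ext n; rfl }
  have hnorm : ∀ u, ‖R u‖ = ‖u‖ := by
    intro u
    have h1 := lp.hasSum_norm_sq (R u)
    have h2 := (Equiv.subRight (1 : ℤ)).hasSum_iff.2 (lp.hasSum_norm_sq u)
    exact (sq_eq_sq₀ (norm_nonneg _) (norm_nonneg _)).1 (h1.unique h2)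
  exact ⟨R.mkContinuous 1 fun u ↦ by rw [hnorm, one_mul], fun u n ↦ rfl, hnorm⟩

variable {a b : ℤ → ℝ} {S : lp (fun _ : ℤ ↦ ℂ) 2 →L[ℂ] lp (fun _ : ℤ ↦ ℂ) 2}

lemma isSymmetric_of_jacobi (hS : ∀ (u : lp (fun _ : ℤ ↦ ℂ) 2) (n : ℤ),
      S u n = (b (n - 1) : ℂ) * u (n - 1) + (a n : ℂ) * u n + (b n : ℂ) * u (n + 1)) :
    S.IsSymmetric := by
  have hsingle : ∀ n : ℤ, S (lp.single 2 n (1 : ℂ)) = lp.single 2 (n + 1) (b n : ℂ)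
      + lp.single 2 n (a n : ℂ) + lp.single 2 (n - 1) (b (n - 1) : ℂ) := by
    intro n
    ext l
    simp only [hS, lp.coeFn_add, Pi.add_apply, lp.single_apply, Pi.single_apply]
    by_cases h1 : l = n + 1
    · subst h1
      simp [show n + 1 + 1 ≠ n by omega, show n + 1 ≠ n - 1 by omega]
    · by_cases h2 : l = n
      · subst h2
        simp [show l ≠ l - 1 by omega]
      · by_cases h3 : l = n - 1
        · subst h3
          simp [show n - 1 - 1 ≠ n by omega, show n - 1 ≠ n + 1 by omega]
        · simp [h1, h2, h3, show l - 1 ≠ n by omega, show l + 1 ≠ n by omega]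
  have hadj : S.adjoint = S := by
    ext u n
    have h1 := lp.inner_single_left (𝕜 := ℂ) (G := fun _ : ℤ ↦ ℂ) n (1 : ℂ) (S.adjoint u)
    rw [ContinuousLinearMap.adjoint_inner_right, hsingle, inner_add_left, inner_add_left,
      lp.inner_single_left, lp.inner_single_left, lp.inner_single_left] at h1
    simp only [RCLike.inner_apply, Complex.conj_ofReal, map_one, mul_one] at h1
    rw [← h1, hS]
    ring
  intro x y
  change ⟪S x, y⟫_ℂ = ⟪x, S y⟫_ℂ
  rw [← ContinuousLinearMap.adjoint_inner_right, hadj]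

/-- A lower bound that holds for all the cyclic Jacobi operators with a given period passes to the
operator on `ℓ²(ℤ)`. -/
lemma norm_le_norm_jacobi_sub {p : ℕ} [NeZero p] (ha : ∀ n : ℤ, a (n + p) = a n)
    (hb : ∀ n : ℤ, b (n + p) = b n)
    (hS : ∀ (u : lp (fun _ : ℤ ↦ ℂ) 2) (n : ℤ),
      S u n = (b (n - 1) : ℂ) * u (n - 1) + (a n : ℂ) * u n + (b n : ℂ) * u (n + 1))
    {δ : ℝ} {e : ℂ}
    (hcyc : ∀ (N : ℕ) [NeZero (N * p)] (α β : ZMod (N * p) → ℝ), (∀ n : ℤ, α n = a n) →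
      (∀ n : ℤ, β n = b n) → ∀ x, δ * ‖x‖ ≤ ‖cyclicJacobi α β x - e • x‖)
    (u : lp (fun _ : ℤ ↦ ℂ) 2) : δ * ‖u‖ ≤ ‖S u - e • u‖ := by
  have hfin : ∀ (u : lp (fun _ : ℤ ↦ ℂ) 2) (s : ℕ), (∀ n : ℤ, n < -s ∨ s < n → u n = 0) →
      δ * ‖u‖ ≤ ‖S u - e • u‖ := by
    intro u s hu
    set N := 2 * s + 3
    have hp1 : 1 ≤ p := NeZero.one_le
    have hNp : 2 * s + 3 ≤ N * p := Nat.le_mul_of_pos_right _ hp1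
    have hne : NeZero (N * p) := ⟨by omega⟩
    obtain ⟨α, hα⟩ := exists_zmod_lift ha N
    obtain ⟨β, hβ⟩ := exists_zmod_lift hb N
    let x : EuclideanSpace ℂ (ZMod (N * p)) :=
      WithLp.toLp 2 fun n ↦ u (((n + ((s + 1 : ℕ) : ZMod (N * p))).val : ℤ) - (s + 1))
    have hx : ∀ v : ℤ, -1 ≤ v → v ≤ (N * p : ℕ) →
        x ((v - (s + 1) : ℤ) : ZMod (N * p)) = u (v - (s + 1)) := by
      intro v hv1 hv2
      have h1 : (((v - (s + 1) : ℤ) : ZMod (N * p)) + ((s + 1 : ℕ) : ZMod (N * p)))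
          = (v : ZMod (N * p)) := by
        push_cast
        ring
      change u (((((v - (s + 1) : ℤ) : ZMod (N * p)) + ((s + 1 : ℕ) : ZMod (N * p))).val : ℤ)
        - (s + 1)) = _
      rw [h1, ZMod.val_intCast]
      rcases hv1.eq_or_lt with rfl | hv1
      · have : (-1 : ℤ) % (N * p : ℕ) = (N * p : ℕ) - 1 := by
          rw [← Int.add_emod_right, Int.emod_eq_of_lt] <;> omega
        rw [this, hu _ (Or.inr (by omega)), hu _ (Or.inl (by omega))]
      rcases hv2.eq_or_lt with rfl | hv2
      · rw [Int.emod_self, hu _ (Or.inl (by omega)), hu _ (Or.inr (by omega))]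
      · rw [Int.emod_eq_of_lt (by omega) hv2]
    have hnorm : ∀ y : EuclideanSpace ℂ (ZMod (N * p)), ‖y‖ ^ 2
        = ∑ v ∈ Finset.range (N * p), ‖y (((v : ℤ) - (s + 1) : ℤ) : ZMod (N * p))‖ ^ 2 := by
      intro y
      rw [EuclideanSpace.norm_sq_eq,
        ← Equiv.sum_comp (Equiv.subRight (((s + 1 : ℕ) : ZMod (N * p)))), ZMod.sum_eq_sum_range]
      refine Finset.sum_congr rfl fun v _ ↦ ?_
      have hv : Equiv.subRight ((s + 1 : ℕ) : ZMod (N * p)) (v : ZMod (N * p))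
          = (((v : ℤ) - (s + 1) : ℤ) : ZMod (N * p)) := by simp
      rw [hv]
    let w : ℕ ↪ ℤ := ⟨fun v ↦ (v : ℤ) - (s + 1), fun v v' h ↦ by simpa using h⟩
    have hxu : ‖x‖ ^ 2 = ‖u‖ ^ 2 := by
      rw [hnorm, ← (lp.hasSum_norm_sq u).tsum_eq,
        tsum_eq_sum (s := (Finset.range (N * p)).map w), Finset.sum_map]
      · refine Finset.sum_congr rfl fun v hv ↦ ?_
        rw [hx v (by omega) (by exact_mod_cast (Finset.mem_range.1 hv).le)]
        rfl
      · intro n hn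
        have hn' : n < -s ∨ s < n := by
          by_contra! h
          refine hn (Finset.mem_map.2 ⟨(n + (s + 1)).toNat, Finset.mem_range.2 (by omega), ?_⟩)
          change (((n + (s + 1)).toNat : ℕ) : ℤ) - (s + 1) = n
          omega
        rw [hu n hn', norm_zero, zero_pow two_ne_zero]
    have hSx : ‖cyclicJacobi α β x - e • x‖ ^ 2 ≤ ‖S u - e • u‖ ^ 2 := by
      rw [hnorm]
      have hterm : ∀ v ∈ Finset.range (N * p),
          ‖(cyclicJacobi α β x - e • x) (((v : ℤ) - (s + 1) : ℤ) : ZMod (N * p))‖ ^ 2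
            = ‖(S u - e • u) (w v)‖ ^ 2 := by
        intro v hv
        have hv' := Finset.mem_range.1 hv
        congr 2
        have hpred : (((v : ℤ) - (s + 1) : ℤ) : ZMod (N * p)) - 1
            = (((v - 1 : ℤ) - (s + 1) : ℤ) : ZMod (N * p)) := by push_cast; ring
        have hsucc : (((v : ℤ) - (s + 1) : ℤ) : ZMod (N * p)) + 1
            = (((v + 1 : ℤ) - (s + 1) : ℤ) : ZMod (N * p)) := by push_cast; ring
        have hwv : w v = (v : ℤ) - (s + 1) := rfl
        have hl : (cyclicJacobi α β x - e • x) (((v : ℤ) - (s + 1) : ℤ) : ZMod (N * p))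
            = (β ((((v : ℤ) - (s + 1) : ℤ) : ZMod (N * p)) - 1) : ℂ)
                * x ((((v : ℤ) - (s + 1) : ℤ) : ZMod (N * p)) - 1)
              + (α (((v : ℤ) - (s + 1) : ℤ) : ZMod (N * p)) : ℂ)
                * x (((v : ℤ) - (s + 1) : ℤ) : ZMod (N * p))
              + (β (((v : ℤ) - (s + 1) : ℤ) : ZMod (N * p)) : ℂ)
                * x ((((v : ℤ) - (s + 1) : ℤ) : ZMod (N * p)) + 1)
              - e * x (((v : ℤ) - (s + 1) : ℤ) : ZMod (N * p)) := rfl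
        have hr : (S u - e • u) (w v) = S u (w v) - e * u (w v) := rfl
        rw [hl, hr, hS, hpred, hsucc, hβ, hβ, hα, hx _ (by omega) (by omega),
          hx _ (by omega) (by omega), hx _ (by omega) (by omega), hwv,
          show (v : ℤ) - 1 - (s + 1) = v - (s + 1) - 1 by ring,
          show (v : ℤ) + 1 - (s + 1) = v - (s + 1) + 1 by ring]
      rw [Finset.sum_congr rfl hterm, ← Finset.sum_map (Finset.range (N * p)) w
        (fun n ↦ ‖(S u - e • u) n‖ ^ 2)]
      exact sum_le_hasSum _ (fun n _ ↦ by positivity) (lp.hasSum_norm_sq _)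
    have h1 := hcyc N α β hα hβ x
    rw [(sq_eq_sq₀ (norm_nonneg _) (norm_nonneg _)).1 hxu] at h1
    exact h1.trans ((sq_le_sq₀ (norm_nonneg _) (norm_nonneg _)).1 hSx)
  have hlim := lp.hasSum_single (p := 2) (by simp) u
  have hcl : Continuous fun v : lp (fun _ : ℤ ↦ ℂ) 2 ↦ δ * ‖v‖ := by fun_prop
  have hcr : Continuous fun v : lp (fun _ : ℤ ↦ ℂ) 2 ↦ ‖S v - e • v‖ := by fun_prop
  refine le_of_tendsto_of_tendsto' ((hcl.tendsto u).comp hlim) ((hcr.tendsto u).comp hlim)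
    fun t ↦ hfin _ (t.sup Int.natAbs) fun n hn ↦ ?_
  have hnt : n ∉ t := by
    intro hnt
    have := Finset.le_sup (f := Int.natAbs) hnt
    omega
  rw [lp.coeFn_sum, Finset.sum_apply]
  refine Finset.sum_eq_zero fun l hl ↦ ?_
  rw [lp.single_apply, Pi.single_eq_of_ne]
  rintro rfl
  exact hnt hl

/-- A Dirichlet eigenvector, extended by zero, realizes its eigenvalue in the quadratic form of the
operator on `ℓ²(ℤ)`. -/
lemma exists_re_inner_jacobi_sub_eq (hS : ∀ (u : lp (fun _ : ℤ ↦ ℂ) 2) (n : ℤ),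
      S u n = (b (n - 1) : ℂ) * u (n - 1) + (a n : ℂ) * u n + (b n : ℂ) * u (n + 1))
    {q : ℕ} {j : ℤ} {ν : ℝ} {y : EuclideanSpace ℂ (Fin q)} (hy : y ≠ 0)
    (hDy : dirichletJacobi q a b j y = (ν : ℂ) • y) (e : ℝ) :
    ∃ u : lp (fun _ : ℤ ↦ ℂ) 2, u ≠ 0 ∧
      (⟪S u - (e : ℂ) • u, u⟫_ℂ).re = (ν - e) * ‖u‖ ^ 2 := by
  have hmem : Memℓp (fun n : ℤ ↦ zeroExtend (n - j) y) 2 := by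
    refine (memℓp_zero ?_).of_exponent_ge zero_le
    refine (Set.finite_Icc (j + 1) (j + q)).subset fun n hn ↦ ?_
    by_contra h
    refine hn (zeroExtend_eq_zero ?_ y)
    rw [Set.mem_Icc] at h
    omega
  let u : lp (fun _ : ℤ ↦ ℂ) 2 := ⟨fun n ↦ zeroExtend (n - j) y, hmem⟩
  have hu : ∀ n, u n = zeroExtend (n - j) y := fun _ ↦ rfl
  have hcoord : ∀ r : Fin q, u (j + r + 1) = y r := by
    intro r
    rw [hu, show j + r + 1 - j = (r : ℤ) + 1 by ring, zeroExtend_succ]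
  refine ⟨u, fun h0 ↦ hy ?_, ?_⟩
  · ext r
    rw [← hcoord, h0]
    rfl
  have hterm : ∀ n : ℤ, ⟪(S u - (e : ℂ) • u) n, u n⟫_ℂ = ((ν - e : ℝ) : ℂ) * ⟪u n, u n⟫_ℂ := by
    intro n
    by_cases h : 1 ≤ n - j ∧ n - j ≤ q
    · obtain ⟨r, rfl⟩ : ∃ r : Fin q, n = j + r + 1 :=
        ⟨⟨(n - j - 1).toNat, by omega⟩, by simp; omega⟩
      have hSu : S u (j + r + 1) = ν * u (j + r + 1) := by
        have h1 := congrArg (fun z : EuclideanSpace ℂ (Fin q) ↦ z r) hDy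
        simp only [dirichletJacobi, LinearMap.coe_mk, AddHom.coe_mk, PiLp.smul_apply,
          smul_eq_mul] at h1
        rw [hcoord, ← h1, hS, hcoord, hu, hu, show j + r + 1 - 1 - j = (r : ℤ) by ring,
          show j + r + 1 + 1 - j = (r : ℤ) + 2 by ring, show j + r + 1 - 1 = j + (r : ℤ) by ring]
      have : (S u - (e : ℂ) • u) (j + r + 1) = ((ν - e : ℝ) : ℂ) * u (j + r + 1) := by
        change S u (j + r + 1) - e * u (j + r + 1) = _
        rw [hSu]
        push_cast
        ring
      rw [this, ← smul_eq_mul, inner_smul_left, Complex.conj_ofReal]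
    · rw [hu, zeroExtend_eq_zero (by omega), inner_zero_right, inner_zero_right, mul_zero]
  rw [lp.inner_eq_tsum, tsum_congr hterm, tsum_mul_left, ← lp.inner_eq_tsum,
    Complex.re_ofReal_mul, ← @inner_self_eq_norm_sq ℂ]
  rfl

/-- If the `ε`-pseudospectrum of a Jacobi operator perturbed by an operator of size `κ` is path
connected, then Dirichlet eigenvalues of the same index differ by at most `2 * (ε + κ)`. -/
lemma eigenvalues_dirichletJacobi_sub_le {q : ℕ} (ha : ∀ n : ℤ, a (n + (q + 1 : ℕ)) = a n)
    (hb : ∀ n : ℤ, b (n + (q + 1 : ℕ)) = b n)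
    (hS : ∀ (u : lp (fun _ : ℤ ↦ ℂ) 2) (n : ℤ),
      S u n = (b (n - 1) : ℂ) * u (n - 1) + (a n : ℂ) * u n + (b n : ℂ) * u (n + 1))
    {K : lp (fun _ : ℤ ↦ ℂ) 2 →L[ℂ] lp (fun _ : ℤ ↦ ℂ) 2} {κ ε : ℝ} (hκ : 0 ≤ κ)
    (hK : ∀ x, ‖K x‖ ≤ κ * ‖x‖) (hε : 0 < ε) (hconn : IsPathConnected (pseudospectrum ε (S + K)))
    (i j : ℤ) (m : Fin q) :
    (dirichletJacobi_isSymmetric ha hb j).eigenvalues finrank_euclideanSpace_fin m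
      - (dirichletJacobi_isSymmetric ha hb i).eigenvalues finrank_euclideanSpace_fin m
      ≤ 2 * (ε + κ) := by
  set hDi := dirichletJacobi_isSymmetric ha hb i
  set hDj := dirichletJacobi_isSymmetric ha hb j
  set ν := hDi.eigenvalues finrank_euclideanSpace_fin m with hν
  set μ := hDj.eigenvalues finrank_euclideanSpace_fin m with hμ
  by_contra! hlt
  have hνμ : ν < μ := by linarith
  obtain ⟨u₁, hu₁, h₁⟩ := exists_re_inner_jacobi_sub_eq (ν := ν) hS
    ((hDi.eigenvectorBasis finrank_euclideanSpace_fin).orthonormal.ne_zero m)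
    (hDi.apply_eigenvectorBasis finrank_euclideanSpace_fin m) ((μ + ν) / 2)
  obtain ⟨u₂, hu₂, h₂⟩ := exists_re_inner_jacobi_sub_eq (ν := μ) hS
    ((hDj.eigenvectorBasis finrank_euclideanSpace_fin).orthonormal.ne_zero m)
    (hDj.apply_eigenvectorBasis finrank_euclideanSpace_fin m) ((μ + ν) / 2)
  have : Nontrivial (lp (fun _ : ℤ ↦ ℂ) 2) := ⟨u₁, 0, hu₁⟩
  refine not_isPathConnected_pseudospectrum (isSymmetric_of_jacobi hS) (δ := (μ - ν) / 2)
    (e := (μ + ν) / 2) hε hκ (by linarith) ?_ hK (x₁ := u₁) (x₂ := u₂) ?_ ?_ hconn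
  · exact norm_le_norm_jacobi_sub ha hb hS fun N _ α β hα hβ x ↦
      norm_le_norm_cyclicJacobi_sub ha hb hα hβ m hν.symm hμ.symm hνμ x
  · rw [h₁]
    exact mul_neg_of_neg_of_pos (by linarith) (pow_pos (norm_pos_iff.2 hu₁) 2)
  · rw [h₂]
    exact mul_pos (by linarith) (pow_pos (norm_pos_iff.2 hu₂) 2)

end BiInfinite

end

theorem osc_le_of_pseudospectrum_pathConnected_constant_difference
    (p : ℕ) (hp : 2 ≤ p) (a b c : ℤ → ℝ)
    (ha : ∀ n : ℤ, a (n + p) = a n) (hb : ∀ n : ℤ, b (n + p) = b n)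
    (hc : ∀ n : ℤ, c (n + p) = c n)
    (k : ℝ) (hk : ∀ i : ℤ, c i - b i = k)
    (J : lp (fun _ : ℤ => ℂ) 2 →L[ℂ] lp (fun _ : ℤ => ℂ) 2)
    (hJ : ∀ u : lp (fun _ : ℤ => ℂ) 2, ∀ n : ℤ,
      J u n = (c (n - 1) : ℂ) * u (n - 1) + (a n : ℂ) * u n + (b n : ℂ) * u (n + 1))
    (ε : ℝ) (hε : 0 < ε) (hconn : IsPathConnected (pseudospectrum ε J)) :
    osc p a ≤ 2 * (ε + |k|) * ((p : ℝ) - 1) := by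
  obtain ⟨q, rfl⟩ : ∃ q, p = q + 1 := ⟨p - 1, by omega⟩
  obtain ⟨R, hR, hRnorm⟩ := exists_rightShift
  have hS : ∀ (u : lp (fun _ : ℤ ↦ ℂ) 2) (n : ℤ), (J - (k : ℂ) • R) u n
      = (b (n - 1) : ℂ) * u (n - 1) + (a n : ℂ) * u n + (b n : ℂ) * u (n + 1) := by
    intro u n
    change J u n - k * R u n = _
    rw [hJ, hR, ← hk (n - 1)]
    push_cast
    ring
  have hK : ∀ u, ‖((k : ℂ) • R) u‖ ≤ |k| * ‖u‖ := by
    intro u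
    rw [smul_apply, norm_smul, hRnorm, Complex.norm_real, Real.norm_eq_abs]
  have hle : ∀ i j : ℤ, a i - a j ≤ 2 * (ε + |k|) * (((q + 1 : ℕ) : ℝ) - 1) := by
    intro i j
    have hsum := Finset.sum_le_sum fun m (_ : m ∈ Finset.univ) ↦
      eigenvalues_dirichletJacobi_sub_le ha hb hS (abs_nonneg k) hK hε
        (by rwa [sub_add_cancel]) i j m
    rw [Finset.sum_sub_distrib, sum_eigenvalues_dirichletJacobi ha hb,
      sum_eigenvalues_dirichletJacobi ha hb,
      Finset.sum_const, Finset.card_univ, Fintype.card_fin, nsmul_eq_mul] at hsum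
    push_cast
    linarith
  exact ciSup_le fun i ↦ ciSup_le fun j ↦ abs_sub_le_iff.2 ⟨hle _ _, hle _ _⟩
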